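/- Any artinian Gorenstein algebra A over an algebraically closed field of characteristic zero with h-vector (1, 4, 4, ..., 4, 1) (socle degree d ≥ 2) has the strong Lefschetz property. -/

import Mathlib

open MvPolynomial

noncomputable section

variable {K : Type*} [Field K] {n : ℕ}

/-- The degree `i` graded piece of the standard graded algebra `R/I`,
where `R = K[x_1,…,x_n]`. -/
def piece (I : Ideal (MvPolynomial (Fin n) K)) (i : ℕ) :
    Submodule K (MvPolynomial (Fin n) K ⧸ I) :=
  (homogeneousSubmodule (Fin n) K i).map (Ideal.Quotient.mkₐ K I).toLinearMap

/-- The Hilbert function of the standard graded algebra `R/I`. -/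
def hf (I : Ideal (MvPolynomial (Fin n) K)) (i : ℕ) : ℕ :=
  Module.finrank K (piece I i)

/-- `I` is a homogeneous ideal. -/
def IsHomogIdeal (I : Ideal (MvPolynomial (Fin n) K)) : Prop :=
  ∀ p ∈ I, ∀ i : ℕ, homogeneousComponent i p ∈ I

/-- The socle of `R/I`: the annihilator of the irrelevant maximal ideal. -/
def socle (I : Ideal (MvPolynomial (Fin n) K)) :
    Submodule K (MvPolynomial (Fin n) K ⧸ I) :=
  ⨅ j : Fin n, LinearMap.ker (LinearMap.mulLeft K (Ideal.Quotient.mk I (X j)))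

/-- `R/I` is a standard graded artinian Gorenstein algebra of socle degree `d`:
`I` is homogeneous, the Hilbert function vanishes above degree `d`, is symmetric,
and the socle is one-dimensional, concentrated in degree `d`. -/
def IsArtinianGorenstein (I : Ideal (MvPolynomial (Fin n) K)) (d : ℕ) : Prop :=
  IsHomogIdeal I ∧ hf I d = 1 ∧ (∀ i : ℕ, d < i → hf I i = 0) ∧
    (∀ i : ℕ, i ≤ d → hf I i = hf I (d - i)) ∧
    Module.finrank K (socle I) = 1 ∧ socle I ≤ piece I d

/-- The weak Lefschetz property for `R/I`: there is a linear form `ℓ` such that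
multiplication `×ℓ : [A]_i → [A]_{i+1}` has maximal rank (is injective or
surjective) for every `i`. -/
def WLP (I : Ideal (MvPolynomial (Fin n) K)) : Prop :=
  ∃ ℓ : MvPolynomial (Fin n) K, ℓ.IsHomogeneous 1 ∧ ∀ i : ℕ,
    (∀ a ∈ piece I i, Ideal.Quotient.mk I ℓ * a = 0 → a = 0) ∨
    (∀ b ∈ piece I (i + 1), ∃ a ∈ piece I i, Ideal.Quotient.mk I ℓ * a = b)

/-- The strong Lefschetz property for `R/I`: there is a linear form `ℓ` such that
`×ℓ^k : [A]_i → [A]_{i+k}` has maximal rank for all `i ≥ 0`, `k ≥ 1`. -/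
def SLP (I : Ideal (MvPolynomial (Fin n) K)) : Prop :=
  ∃ ℓ : MvPolynomial (Fin n) K, ℓ.IsHomogeneous 1 ∧ ∀ i k : ℕ, 1 ≤ k →
    ((∀ a ∈ piece I i, Ideal.Quotient.mk I ℓ ^ k * a = 0 → a = 0) ∨
     (∀ b ∈ piece I (i + k), ∃ a ∈ piece I i, Ideal.Quotient.mk I ℓ ^ k * a = b))

/-- The action of `p ∈ R = K[x_1,…,x_n]` on `S = K[X_1,…,X_n]` by differentiation,
`x_i` acting as `∂/∂X_i`. -/
def diffOp (p : MvPolynomial (Fin n) K) :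
    Module.End K (MvPolynomial (Fin n) K) :=
  ∑ m ∈ p.support, MvPolynomial.coeff m p •
    (List.ofFn fun j : Fin n =>
      ((pderiv j).toLinearMap : Module.End K (MvPolynomial (Fin n) K)) ^ (m j)).prod

/-- The degree-`d` graded piece of the inverse system `I^⊥ = {F : g ∘ F = 0 ∀ g ∈ I}`. -/
def invSys (I : Ideal (MvPolynomial (Fin n) K)) (d : ℕ) :
    Submodule K (MvPolynomial (Fin n) K) :=
  homogeneousSubmodule (Fin n) K d ⊓ ⨅ g ∈ I, LinearMap.ker (diffOp g)

end

section core
variable {K A : Type*} [Field K] [CommRing A] [Algebra K A]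

/-- A polynomial over a `K`-algebra vanishing at all `K`-points is zero. -/
lemma aux_apply_eval (ψ : A →ₗ[K] K) {n : ℕ} (f : MvPolynomial (Fin n) A) :
    ∃ g : MvPolynomial (Fin n) K, (∀ m, coeff m g = ψ (coeff m f)) ∧
      ∀ p : Fin n → K, eval p g = ψ (eval (fun i => algebraMap K A (p i)) f) := by
  classical
  induction f using MvPolynomial.induction_on' with
  | monomial u a =>
    refine ⟨monomial u (ψ a), fun m => ?_, fun p => ?_⟩
    · simp only [coeff_monomial]; split_ifs <;> simp
    · simp only [eval_monomial]
      have : (u.prod fun i k => (algebraMap K A (p i)) ^ k)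
          = algebraMap K A (u.prod fun i k => (p i) ^ k) := by
        simp [Finsupp.prod, map_prod]
      rw [this, mul_comm a, ← Algebra.smul_def, map_smul, smul_eq_mul, mul_comm]
  | add f1 f2 h1 h2 =>
    obtain ⟨g1, c1, e1⟩ := h1
    obtain ⟨g2, c2, e2⟩ := h2
    exact ⟨g1 + g2, fun m => by simp [c1, c2], fun p => by simp [e1, e2]⟩

lemma aux_funext [Infinite K] {n : ℕ} (f : MvPolynomial (Fin n) A)
    (h : ∀ p : Fin n → K, eval (fun i => algebraMap K A (p i)) f = 0) : f = 0 := by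
  ext m
  rw [coeff_zero, ← Module.forall_dual_apply_eq_zero_iff K]
  intro ψ
  obtain ⟨g, c, e⟩ := aux_apply_eval ψ f
  have : g = 0 := MvPolynomial.funext fun p => by rw [e, h]; simp
  rw [← c, this]; simp

/-- Over a proper subspace some nonzero polynomial vanishes. -/
lemma aux_subspace {n : ℕ} (H : Submodule K (Fin n → K)) (hH : H ≠ ⊤) :
    ∃ L : MvPolynomial (Fin n) K, L ≠ 0 ∧ ∀ p ∈ H, eval p L = 0 := by
  obtain ⟨φ, hφ, hle⟩ := Submodule.exists_le_ker_of_lt_top H (lt_top_iff_ne_top.2 hH)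
  have key : ∀ p, eval p (∑ i, C (φ (Pi.single i 1)) * X i : MvPolynomial (Fin n) K) = φ p := by
    intro p
    conv_rhs => rw [← Finset.univ_sum_single p]
    simp only [map_sum, map_mul, eval_C, eval_X]
    refine Finset.sum_congr rfl fun i _ => ?_
    have : (Pi.single i (p i) : Fin n → K) = p i • Pi.single i 1 := by
      rw [← Pi.single_smul]; simp
    simp [this, mul_comm]
  refine ⟨_, fun h => hφ ?_, fun p hp => (key p).trans (hle hp)⟩
  ext i
  have := key (Pi.single i 1)
  rw [h] at this
  simpa using this.symm

lemma aux_exists_point [Infinite K] {n : ℕ} (L : MvPolynomial (Fin n) K) (h : L ≠ 0) :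
    ∃ p, eval p L ≠ 0 := by
  by_contra! hh
  exact h (MvPolynomial.funext fun p => by simp [hh])

/-- Rank estimate. -/
lemma aux_rank {B : Type*} [AddCommGroup B] [Module K B] (f g : (Fin 4 → K) →ₗ[K] B)
    (N : (Fin 4 → K) →ₗ[K] (Fin 4 → K)) (u : Fin 4 → K) (hu : u ≠ 0)
    (h1 : ∀ v, f v = - g (N v)) (h2 : ∀ v, f (N v) = 0) (h3 : f u = 0) (h4 : g u = 0) :
    3 ≤ Module.finrank K (LinearMap.ker f) := by
  set W := LinearMap.range N ⊔ Submodule.span K {u} with hW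
  have hWf : W ≤ LinearMap.ker f := by
    refine sup_le ?_ ?_
    · rintro _ ⟨v, rfl⟩; exact h2 v
    · rw [Submodule.span_singleton_le_iff_mem]; exact h3
  have hr : LinearMap.range f ≤ LinearMap.range (g.domRestrict W) := by
    rintro _ ⟨v, rfl⟩
    refine ⟨⟨N (-v), ?_⟩, ?_⟩
    · exact Submodule.mem_sup_left ⟨_, rfl⟩
    · simp [h1]
  have e1 := LinearMap.finrank_range_add_finrank_ker f
  have e2 := LinearMap.finrank_range_add_finrank_ker (g.domRestrict W)
  have e3 := Submodule.finrank_mono hWf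
  have e4 := Submodule.finrank_mono hr
  have e5 : 1 ≤ Module.finrank K (LinearMap.ker (g.domRestrict W)) := by
    rw [Nat.one_le_iff_ne_zero, Ne, Submodule.finrank_eq_zero, Submodule.eq_bot_iff]
    push Not
    refine ⟨⟨u, Submodule.mem_sup_right (Submodule.mem_span_singleton_self u)⟩, h4, ?_⟩
    simpa using hu
  simp at e1
  omega

/-- Two distinct hyperplanes span. -/
lemma aux_sup (H1 H2 : Submodule K (Fin 4 → K)) (h1 : 3 ≤ Module.finrank K H1)
    (p : Fin 4 → K) (hp : p ∈ H2) (hp' : p ∉ H1) :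
    H1 ⊔ H2 = ⊤ := by
  apply Submodule.eq_top_of_finrank_eq
  have hlt : H1 < H1 ⊔ H2 := by
    refine lt_of_le_of_ne le_sup_left fun h => hp' ?_
    rw [h]; exact Submodule.mem_sup_right hp
  have := Submodule.finrank_lt_finrank_of_lt hlt
  have h4 := Submodule.finrank_le (H1 ⊔ H2)
  simp at h4 ⊢
  omega

/-- No three isotropic rank-one elements with distinct kernels. -/
lemma aux_three (E : (Fin 4 → K) →ₗ[K] A)
    (nd2 : ∀ v w, (∀ z, E v * E w * E z = 0) → E v * E w = 0)
    (u1 u2 u3 p2 p3 : Fin 4 → K)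
    (h1 : u1 ≠ 0) (h2 : u2 ≠ 0) (h3 : u3 ≠ 0)
    (s1 : E u1 * E u1 = 0) (s2 : E u2 * E u2 = 0)
    (F : (Fin 4 → K) → (Fin 4 → K) →ₗ[K] A) (hF : ∀ u v, F u v = E u * E v)
    (k1 : 3 ≤ Module.finrank K (LinearMap.ker (F u1)))
    (k2 : 3 ≤ Module.finrank K (LinearMap.ker (F u2)))
    (p22 : E u2 * E p2 = 0) (p12 : E u1 * E p2 ≠ 0)
    (p33 : E u3 * E p3 = 0) (p13 : E u1 * E p3 ≠ 0) (p23 : E u2 * E p3 ≠ 0) : False := by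
  have mem : ∀ u v, v ∈ LinearMap.ker (F u) ↔ E u * E v = 0 := fun u v => by
    rw [LinearMap.mem_ker, hF]
  have nt : ∀ u p, E u * E p ≠ 0 → LinearMap.ker (F u) ≠ ⊤ := fun u p h ht => by
    apply h; rw [← mem, ht]; trivial
  have sup12 := aux_sup _ _ k1 p2 ((mem _ _).2 p22) (by rwa [mem])
  have sup13 := aux_sup _ _ k1 p3 ((mem _ _).2 p33) (by rwa [mem])
  have sup23 := aux_sup _ _ k2 p3 ((mem _ _).2 p33) (by rwa [mem])
  have key : ∀ u u' v w, LinearMap.ker (F u) ⊔ LinearMap.ker (F u') = ⊤ →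
      E u * E v = E u' * E w → E u * E v = 0 := by
    intro u u' v w hs he
    refine nd2 _ _ fun z => ?_
    have hz : z ∈ LinearMap.ker (F u) ⊔ LinearMap.ker (F u') := by rw [hs]; trivial
    obtain ⟨a, ha, b, hb, rfl⟩ := Submodule.mem_sup.1 hz
    rw [mem] at ha hb
    rw [map_add, mul_add]
    have t1 : E u * E v * E a = 0 := by rw [mul_right_comm, ha, zero_mul]
    have t2 : E u * E v * E b = 0 := by rw [he, mul_right_comm, hb, zero_mul]
    rw [t1, t2, add_zero]
  have z12 : E u1 * E u2 = 0 := key u1 u2 u2 u1 sup12 (mul_comm _ _)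
  have z13 : E u1 * E u3 = 0 := key u1 u3 u3 u1 sup13 (mul_comm _ _)
  have z23 : E u2 * E u3 = 0 := key u2 u3 u3 u2 sup23 (mul_comm _ _)
  have z21 : E u2 * E u1 = 0 := by rw [mul_comm]; exact z12
  have li : LinearIndependent K ![u1, u2] := by
    rw [LinearIndependent.pair_iff' h1]
    intro c hc
    have hc0 : c ≠ 0 := by rintro rfl; exact h2 (by simpa using hc.symm)
    rw [← hc, map_smul, smul_mul_assoc] at p22
    exact p12 ((smul_eq_zero.1 p22).resolve_left hc0)
  have hdim := Submodule.finrank_sup_add_finrank_inf_eq (LinearMap.ker (F u1)) (LinearMap.ker (F u2))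
  rw [sup12] at hdim
  have l1 := Submodule.finrank_lt (nt _ _ p12)
  have l2 := Submodule.finrank_lt (nt _ _ p23)
  simp at hdim l1 l2
  have hsp : Submodule.span K (Set.range ![u1, u2]) = LinearMap.ker (F u1) ⊓ LinearMap.ker (F u2) := by
    apply Submodule.eq_of_le_of_finrank_le
    · rw [Submodule.span_le]
      rintro _ ⟨i, rfl⟩
      fin_cases i
      · exact ⟨(mem _ _).2 s1, (mem _ _).2 z21⟩
      · exact ⟨(mem _ _).2 z12, (mem _ _).2 s2⟩
    · rw [finrank_span_eq_card li]; simp; omega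
  have hu3 : u3 ∈ Submodule.span K (Set.range ![u1, u2]) := by
    rw [hsp]; exact ⟨(mem _ _).2 z13, (mem _ _).2 z23⟩
  simp only [Matrix.range_cons, Matrix.range_empty, Set.union_empty, Set.singleton_union] at hu3
  obtain ⟨a, b, hab⟩ := Submodule.mem_span_pair.1 hu3
  rw [← hab, map_add, map_smul, map_smul, add_mul, smul_mul_assoc, smul_mul_assoc] at p33
  have q : E u1 * E (a • p3) = 0 := by
    apply key u1 u2 (a • p3) (-(b • p3)) sup12
    simp only [map_smul, map_neg, mul_neg, mul_smul_comm]
    exact eq_neg_of_add_eq_zero_left p33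
  rw [map_smul, mul_smul_comm] at q
  have ha : a = 0 := (smul_eq_zero.1 q).resolve_right p13
  rw [q, zero_add] at p33
  have hb : b = 0 := (smul_eq_zero.1 p33).resolve_right p23
  apply h3
  rw [← hab, ha, hb]; simp

/-- If multiplication by a generic linear form has a kernel we reach a contradiction. -/
lemma aux_kernel [CharZero K] (E : (Fin 4 → K) →ₗ[K] A)
    (nd1 : ∀ v, (∀ z, E v * E z = 0) → v = 0)
    (nd2 : ∀ v w, (∀ z, E v * E w * E z = 0) → E v * E w = 0)
    (Y : Fin 4 → MvPolynomial (Fin 4) K) (hY : Y ≠ 0)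
    (hk : ∀ p, E p * E (fun j => eval p (Y j)) = 0) : False := by
  classical
  set y : (Fin 4 → K) → (Fin 4 → K) := fun p j => eval p (Y j) with hy
  set dy : Fin 4 → (Fin 4 → K) → (Fin 4 → K) := fun l p j => eval p (pderiv l (Y j)) with hdy
  set e : Fin 4 → A := fun i => E (Pi.single i 1) with he
  have hE : ∀ v, E v = ∑ i, algebraMap K A (v i) * e i := by
    intro v
    conv_lhs => rw [← Finset.univ_sum_single v]
    rw [map_sum]
    refine Finset.sum_congr rfl fun i _ => ?_
    have : (Pi.single i (v i) : Fin 4 → K) = v i • Pi.single i 1 := by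
      rw [← Pi.single_smul]; simp
    rw [this, map_smul, Algebra.smul_def]
  set x : MvPolynomial (Fin 4) A := ∑ i, X i * C (e i) with hx
  set YY : MvPolynomial (Fin 4) A := ∑ j, map (algebraMap K A) (Y j) * C (e j) with hYY
  set ι : (Fin 4 → K) → (Fin 4 → A) := fun p i => algebraMap K A (p i) with hι
  have evmap : ∀ (p : Fin 4 → K) (f : MvPolynomial (Fin 4) K),
      eval (ι p) (map (algebraMap K A) f) = algebraMap K A (eval p f) := by
    intro p f
    rw [eval_map]
    exact (eval₂_comp (algebraMap K A) p f).symm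
  have evx : ∀ p, eval (ι p) x = E p := by
    intro p; rw [hE]; simp [hx, hι]
  have evY : ∀ p, eval (ι p) YY = E (y p) := by
    intro p; rw [hE]; simp [hYY, evmap, hy]
  have dYY : ∀ l, pderiv l YY = ∑ j, map (algebraMap K A) (pderiv l (Y j)) * C (e j) := by
    intro l; simp [hYY, pderiv_map, mul_comm]
  have dx : ∀ l, pderiv l x = C (e l) := by
    intro l; simp [hx, pderiv_X, Pi.single_apply]
  have evdY : ∀ l p, eval (ι p) (pderiv l YY) = E (dy l p) := by
    intro l p; rw [hE, dYY]; simp [evmap, hdy]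
  have xY : x * YY = 0 := aux_funext _ fun p => by
    change eval (ι p) _ = 0
    rw [map_mul, evx, evY]; exact hk p
  have d1 : ∀ l p, e l * E (y p) + E p * E (dy l p) = 0 := by
    intro l p
    have := congrArg (fun f => eval (ι p) (pderiv l f)) xY
    simp only [Derivation.leibniz, smul_eq_mul, map_add, map_mul, map_zero, dx, evx, evY, evdY,
      eval_C] at this
    linear_combination this
  have yy : ∀ p, E (y p) * E (y p) = 0 := by
    intro p
    refine nd2 _ _ fun z => ?_
    rw [hE z, Finset.mul_sum]
    refine Finset.sum_eq_zero fun l _ => ?_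
    linear_combination (algebraMap K A (z l) * E (y p)) * d1 l p
      - (algebraMap K A (z l) * E (dy l p)) * hk p
  have YY2 : YY * YY = 0 := aux_funext _ fun p => by
    change eval (ι p) _ = 0
    rw [map_mul, evY]; exact yy p
  have d2 : ∀ l p, E (y p) * E (dy l p) = 0 := by
    intro l p
    have := congrArg (fun f => eval (ι p) (pderiv l f)) YY2
    simp only [Derivation.leibniz, smul_eq_mul, map_add, map_mul, map_zero, evY, evdY] at this
    have h2 : (2 : K) • (E (y p) * E (dy l p)) = 0 := by rw [two_smul]; exact this
    exact (smul_eq_zero.1 h2).resolve_left two_ne_zero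
  -- multiplication maps
  let F : (Fin 4 → K) → (Fin 4 → K) →ₗ[K] A := fun u => (LinearMap.mulLeft K (E u)).comp E
  have hF : ∀ u v, F u v = E u * E v := fun u v => rfl
  have rk : ∀ p, y p ≠ 0 → 3 ≤ Module.finrank K (LinearMap.ker (F (y p))) := by
    intro p hp
    let N : (Fin 4 → K) →ₗ[K] (Fin 4 → K) := ∑ l, (LinearMap.proj l).smulRight (dy l p)
    have hN : ∀ v, E (N v) = ∑ l, algebraMap K A (v l) * E (dy l p) := by
      intro v; simp only [← Algebra.smul_def]; simp [N]
    refine aux_rank (F (y p)) (F p) N (y p) hp (fun v => ?_) (fun v => ?_) (yy p) (hk p)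
    · rw [hF, hF, hN, hE v, Finset.mul_sum, Finset.mul_sum, ← Finset.sum_neg_distrib]
      refine Finset.sum_congr rfl fun l _ => ?_
      linear_combination algebraMap K A (v l) * d1 l p
    · rw [hF, hN, Finset.mul_sum]
      refine Finset.sum_eq_zero fun l _ => ?_
      linear_combination algebraMap K A (v l) * d2 l p
  have kt : ∀ u, u ≠ 0 → LinearMap.ker (F u) ≠ ⊤ := by
    intro u hu ht
    apply hu
    refine nd1 u fun z => ?_
    have : z ∈ LinearMap.ker (F u) := by rw [ht]; trivial
    exact this
  obtain ⟨j0, hj0⟩ : ∃ j, Y j ≠ 0 := by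
    by_contra! h; exact hY (funext h)
  have yne : ∀ p, eval p (Y j0) ≠ 0 → y p ≠ 0 := fun p h h' => h (congrFun h' j0)
  obtain ⟨p1, hp1⟩ := aux_exists_point _ hj0
  obtain ⟨L1, hL1, hL1'⟩ := aux_subspace _ (kt _ (yne _ hp1))
  obtain ⟨p2, hp2⟩ := aux_exists_point _ (mul_ne_zero hj0 hL1)
  rw [map_mul] at hp2
  have hp2a := left_ne_zero_of_mul hp2
  have hp2b := right_ne_zero_of_mul hp2
  obtain ⟨L2, hL2, hL2'⟩ := aux_subspace _ (kt _ (yne _ hp2a))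
  obtain ⟨p3, hp3⟩ := aux_exists_point _ (mul_ne_zero (mul_ne_zero hj0 hL1) hL2)
  rw [map_mul, map_mul] at hp3
  have hp3c := right_ne_zero_of_mul hp3
  have hp3a := left_ne_zero_of_mul (left_ne_zero_of_mul hp3)
  have hp3b := right_ne_zero_of_mul (left_ne_zero_of_mul hp3)
  exact aux_three E nd2 (y p1) (y p2) (y p3) p2 p3 (yne _ hp1) (yne _ hp2a) (yne _ hp3a)
    (yy _) (yy _) F hF (rk _ (yne _ hp1)) (rk _ (yne _ hp2a))
    (by rw [mul_comm]; exact hk p2) (fun h => hp2b (hL1' p2 h))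
    (by rw [mul_comm]; exact hk p3) (fun h => hp3b (hL1' p3 h)) (fun h => hp3c (hL2' p3 h))

/-- Generic surjectivity of multiplication by a linear form onto a four-dimensional `P`. -/
lemma aux_generic [CharZero K] (E : (Fin 4 → K) →ₗ[K] A) (P : Submodule K A)
    (hP : Module.finrank K P = 4) (hEP : ∀ v w, E v * E w ∈ P)
    (nd1 : ∀ v, (∀ z, E v * E z = 0) → v = 0)
    (nd2 : ∀ v w, (∀ z, E v * E w * E z = 0) → E v * E w = 0) :
    ∃ D : MvPolynomial (Fin 4) K, D ≠ 0 ∧ ∀ p, eval p D ≠ 0 → ∀ b ∈ P, ∃ v, E p * E v = b := by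
  classical
  have : FiniteDimensional K P := FiniteDimensional.of_finrank_pos (by omega)
  let φ : P ≃ₗ[K] (Fin 4 → K) := LinearEquiv.ofFinrankEq _ _ (by simp [hP])
  let B : (Fin 4 → K) → (Fin 4 → K) →ₗ[K] P := fun v =>
    ((LinearMap.mulLeft K (E v)).comp E).codRestrict P (fun w => hEP v w)
  have hB : ∀ v w, (B v w : A) = E v * E w := fun v w => rfl
  let s : Fin 4 → (Fin 4 → K) := fun i => Pi.single i 1
  have hs : ∀ v : Fin 4 → K, v = ∑ i, v i • s i := by
    intro v
    conv_lhs => rw [← Finset.univ_sum_single v]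
    refine Finset.sum_congr rfl fun i _ => ?_
    simp only [s]
    rw [← Pi.single_smul]; simp
  let M : Matrix (Fin 4) (Fin 4) (MvPolynomial (Fin 4) K) :=
    fun k j => ∑ i, X i * C (φ (B (s i) (s j)) k)
  have hBs : ∀ p v, B p v = ∑ i, ∑ j, (p i * v j) • B (s i) (s j) := by
    intro p v
    apply Subtype.ext
    rw [hB]
    conv_lhs => rw [hs p, hs v]
    simp [hB, Finset.sum_mul_sum, smul_smul, mul_comm]
  have hM : ∀ p v k, ∑ j, eval p (M k j) * v j = φ (B p v) k := by
    intro p v k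
    rw [hBs]
    simp only [map_sum, map_smul, Finset.sum_apply, Pi.smul_apply, smul_eq_mul, M, map_mul, eval_X,
      eval_C, Finset.sum_mul]
    rw [Finset.sum_comm]
    refine Finset.sum_congr rfl fun i _ => Finset.sum_congr rfl fun j _ => by ring
  refine ⟨M.det, fun h0 => ?_, fun p hp b hb => ?_⟩
  · obtain ⟨Y, hY, hMY⟩ := Matrix.exists_mulVec_eq_zero_iff.2 h0
    refine aux_kernel E nd1 nd2 Y hY fun p => ?_
    rw [← hB]
    have : B p (fun j => eval p (Y j)) = 0 := by
      apply φ.injective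
      ext k
      rw [← hM]
      have := congrArg (eval p) (congrFun hMY k)
      simpa [Matrix.mulVec, dotProduct] using this
    rw [this]; rfl
  · let Mp : Matrix (Fin 4) (Fin 4) K := M.map (eval p)
    have hdet : IsUnit Mp.det := by
      rw [isUnit_iff_ne_zero]
      have : Mp.det = eval p M.det := by
        rw [RingHom.map_det]; rfl
      rwa [this]
    obtain ⟨v, hv⟩ := (Matrix.mulVec_surjective_iff_isUnit.2
      ((Matrix.isUnit_iff_isUnit_det _).2 hdet)) (φ ⟨b, hb⟩)
    refine ⟨v, ?_⟩
    rw [← hB]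
    have : B p v = ⟨b, hb⟩ := by
      apply φ.injective
      ext k
      rw [← hM, ← hv]
      simp [Mp, Matrix.mulVec, dotProduct]
    rw [this]

/-- Some power of a linear form is nonzero, generically. -/
lemma aux_power [CharZero K] (E : (Fin 4 → K) →ₗ[K] A) (P : ℕ → Submodule K A)
    (hPs : ∀ i, ∀ a ∈ P (i + 1), ∃ b : Fin 4 → A, (∀ l, b l ∈ P i) ∧
      a = ∑ l, E (Pi.single l 1) * b l)
    (d : ℕ) (hne : P d ≠ ⊥) :
    ∃ G : MvPolynomial (Fin 4) K, G ≠ 0 ∧ ∀ p, eval p G ≠ 0 → E p ^ d ≠ 0 := by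
  classical
  set e : Fin 4 → A := fun i => E (Pi.single i 1) with he
  have hE : ∀ v, E v = ∑ i, algebraMap K A (v i) * e i := by
    intro v
    conv_lhs => rw [← Finset.univ_sum_single v]
    rw [map_sum]
    refine Finset.sum_congr rfl fun i _ => ?_
    have : (Pi.single i (v i) : Fin 4 → K) = v i • Pi.single i 1 := by
      rw [← Pi.single_smul]; simp
    rw [this, map_smul, Algebra.smul_def]
  set x : MvPolynomial (Fin 4) A := ∑ i, X i * C (e i) with hx
  have dx : ∀ l, pderiv l x = C (e l) := by
    intro l; simp [hx, pderiv_X, Pi.single_apply]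
  have evx : ∀ p : Fin 4 → K, eval (fun i => algebraMap K A (p i)) x = E p := by
    intro p; rw [hE]; simp [hx]
  have key : ∀ j, ∀ a : A, C a * x ^ j = 0 → ∀ m ∈ P j, a * m = 0 := by
    intro j
    induction j with
    | zero =>
      intro a ha m hm
      rw [pow_zero, mul_one, C_eq_zero] at ha
      rw [ha, zero_mul]
    | succ j ih =>
      intro a ha m hm
      obtain ⟨b, hb, rfl⟩ := hPs j m hm
      rw [Finset.mul_sum]
      refine Finset.sum_eq_zero fun l _ => ?_
      rw [← mul_assoc]
      refine ih _ ?_ _ (hb l)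
      have := congrArg (pderiv l) ha
      simp only [Derivation.leibniz, Derivation.leibniz_pow, dx, pderiv_C, smul_eq_mul, map_zero,
        mul_zero, add_zero, Nat.add_sub_cancel, nsmul_eq_mul] at this
      have h2 : ((j + 1 : ℕ) : K) • (C (a * e l) * x ^ j) = 0 := by
        rw [Nat.cast_smul_eq_nsmul, nsmul_eq_mul, C_mul]
        linear_combination this
      exact (smul_eq_zero.1 h2).resolve_left (Nat.cast_ne_zero.2 (Nat.succ_ne_zero j))
  have hxd : x ^ d ≠ 0 := by
    intro h
    apply hne
    rw [Submodule.eq_bot_iff]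
    intro m hm
    simpa using key d 1 (by rw [h, mul_zero]) m hm
  obtain ⟨m, hm⟩ := MvPolynomial.ne_zero_iff.1 hxd
  obtain ⟨ψ, hψ⟩ : ∃ ψ : A →ₗ[K] K, ψ (coeff m (x ^ d)) ≠ 0 := by
    by_contra! h
    exact hm ((Module.forall_dual_apply_eq_zero_iff K _).1 h)
  obtain ⟨G, hc, hev⟩ := aux_apply_eval ψ (x ^ d)
  refine ⟨G, fun h => hψ ?_, fun p hp h => hp ?_⟩
  · rw [← hc, h, coeff_zero]
  · rw [hev, map_pow, evx, h, map_zero]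

end core

section pieces
variable {K : Type*} [Field K] (I : Ideal (MvPolynomial (Fin 4) K))

lemma mem_piece (i : ℕ) (a : MvPolynomial (Fin 4) K ⧸ I) :
    a ∈ piece I i ↔ ∃ f : MvPolynomial (Fin 4) K, f.IsHomogeneous i ∧ Ideal.Quotient.mk I f = a :=
  Iff.rfl

lemma piece_mul {i j : ℕ} {a b : MvPolynomial (Fin 4) K ⧸ I} (ha : a ∈ piece I i)
    (hb : b ∈ piece I j) : a * b ∈ piece I (i + j) := by
  rw [mem_piece] at *
  obtain ⟨f, hf, rfl⟩ := ha
  obtain ⟨g, hg, rfl⟩ := hb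
  exact ⟨f * g, hf.mul hg, map_mul _ _ _⟩

lemma homog_succ (i : ℕ) (f : MvPolynomial (Fin 4) K) (hf : f.IsHomogeneous (i + 1)) :
    ∃ g : Fin 4 → MvPolynomial (Fin 4) K, (∀ l, (g l).IsHomogeneous i) ∧ f = ∑ l, X l * g l := by
  have h : f ∈ homogeneousSubmodule (Fin 4) K 1 * homogeneousSubmodule (Fin 4) K i := by
    rw [← homogeneousSubmodule_one_pow K i, ← pow_succ', homogeneousSubmodule_one_pow]
    exact hf
  induction h using Submodule.mul_induction_on' with
  | mem_mul_mem a ha b hb =>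
    rw [homogeneousSubmodule_one_eq_span_X, Submodule.mem_span_range_iff_exists_fun] at ha
    obtain ⟨c, rfl⟩ := ha
    refine ⟨fun l => C (c l) * b, fun l => IsHomogeneous.C_mul hb _, ?_⟩
    rw [Finset.sum_mul]
    refine Finset.sum_congr rfl fun l _ => ?_
    rw [smul_eq_C_mul]; ring
  | add a ha b hb h1 h2 =>
    have key : ∀ a, a ∈ homogeneousSubmodule (Fin 4) K 1 * homogeneousSubmodule (Fin 4) K i →
        a.IsHomogeneous (i + 1) := fun a ha => by
      have := homogeneousSubmodule_mul (σ := Fin 4) (R := K) 1 i ha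
      rw [add_comm]; exact this
    obtain ⟨g1, k1, e1⟩ := h1 (key a ha)
    obtain ⟨g2, k2, e2⟩ := h2 (key b hb)
    refine ⟨fun l => g1 l + g2 l, fun l => (k1 l).add (k2 l), ?_⟩
    rw [e1, e2, ← Finset.sum_add_distrib]
    exact Finset.sum_congr rfl fun l _ => by ring

lemma piece_succ (i : ℕ) (a : MvPolynomial (Fin 4) K ⧸ I) (ha : a ∈ piece I (i + 1)) :
    ∃ b : Fin 4 → MvPolynomial (Fin 4) K ⧸ I, (∀ l, b l ∈ piece I i) ∧
      a = ∑ l, Ideal.Quotient.mk I (X l) * b l := by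
  obtain ⟨f, hf, rfl⟩ := (mem_piece I _ _).1 ha
  obtain ⟨g, hg, rfl⟩ := homog_succ i f hf
  exact ⟨fun l => Ideal.Quotient.mk I (g l), fun l => (mem_piece I _ _).2 ⟨_, hg l, rfl⟩,
    by simp⟩

lemma piece_zero (a : MvPolynomial (Fin 4) K ⧸ I) (ha : a ∈ piece I 0) :
    ∃ c : K, a = algebraMap K _ c := by
  obtain ⟨f, hf, rfl⟩ := (mem_piece I _ _).1 ha
  obtain ⟨c, hc⟩ : ∃ c, f = C c := by
    have := (totalDegree_zero_iff_isHomogeneous _).2 hf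
    exact ⟨_, totalDegree_eq_zero_iff_eq_C.1 this⟩
  exact ⟨c, by rw [hc]; rfl⟩

instance piece_finite (i : ℕ) : FiniteDimensional K (piece I i) := by
  have : (piece I i).FG := (homogeneousSubmodule_fg (Fin 4) K i).map _
  exact Module.Finite.iff_fg.2 this

lemma piece_disjoint (hI : IsHomogIdeal I) {i j : ℕ} (hij : i ≠ j)
    (a : MvPolynomial (Fin 4) K ⧸ I) (hi : a ∈ piece I i) (hj : a ∈ piece I j) : a = 0 := by
  obtain ⟨f, hf, rfl⟩ := (mem_piece I _ _).1 hi
  obtain ⟨g, hg, hfg⟩ := (mem_piece I _ _).1 hj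
  have h1 : f - g ∈ I := (Ideal.Quotient.eq).1 hfg.symm
  have h2 := hI _ h1 i
  rw [map_sub, homogeneousComponent_of_mem (m := i) hf, homogeneousComponent_of_mem (m := i) hg,
    if_pos rfl, if_neg hij, sub_zero] at h2
  exact Ideal.Quotient.eq_zero_iff_mem.2 h2

/-- The parametrisation of linear forms in the quotient. -/
noncomputable def linForm : (Fin 4 → K) →ₗ[K] (MvPolynomial (Fin 4) K ⧸ I) :=
  Fintype.linearCombination K (fun i => Ideal.Quotient.mk I (X i))

lemma linForm_single (l : Fin 4) : linForm I (Pi.single l 1) = Ideal.Quotient.mk I (X l) := by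
  classical
  simp [linForm]

lemma linForm_lift (p : Fin 4 → K) : ∃ ℓ : MvPolynomial (Fin 4) K, ℓ.IsHomogeneous 1 ∧
    Ideal.Quotient.mk I ℓ = linForm I p := by
  refine ⟨∑ i, C (p i) * X i, IsHomogeneous.sum _ _ _ fun i _ => isHomogeneous_C_mul_X _ _, ?_⟩
  rw [map_sum, linForm, Fintype.linearCombination_apply]
  refine Finset.sum_congr rfl fun i _ => ?_
  rw [← smul_eq_C_mul]; rfl

lemma linForm_mem (p : Fin 4 → K) : linForm I p ∈ piece I 1 := (mem_piece I _ _).2 (linForm_lift I p)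

lemma linForm_range : LinearMap.range (linForm I) = piece I 1 := by
  classical
  apply le_antisymm
  · rintro _ ⟨p, rfl⟩; exact linForm_mem I p
  · intro a ha
    obtain ⟨b, hb, rfl⟩ := piece_succ I 0 a ha
    refine Submodule.sum_mem _ fun l _ => ?_
    obtain ⟨c, hc⟩ := piece_zero I _ (hb l)
    rw [hc, mul_comm, ← Algebra.smul_def, ← linForm_single]
    exact Submodule.smul_mem _ _ ⟨_, rfl⟩

/-- Generic linear form: surjective from degree one to degree two, and `d`-th power nonzero. -/
lemma slp_of_form (d : ℕ) (hz : ∀ i, d < i → hf I i = 0) (p : Fin 4 → K)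
    (hp : linForm I p ^ d ≠ 0)
    (hs : ∀ b ∈ piece I 2, ∃ a ∈ piece I 1, linForm I p * a = b) : SLP I := by
  obtain ⟨ℓ, hℓ, hℓe⟩ := linForm_lift I p
  refine ⟨ℓ, hℓ, fun i k hk => ?_⟩
  rw [hℓe]
  rcases Nat.eq_zero_or_pos i with rfl | hi
  · by_cases hkd : k ≤ d
    · left
      intro a ha h
      obtain ⟨c, rfl⟩ := piece_zero I a ha
      rw [mul_comm, ← Algebra.smul_def] at h
      rcases smul_eq_zero.1 h with h | h
      · rw [h, map_zero]
      · exact absurd (pow_eq_zero_of_le hkd h) hp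
    · right
      intro b hb
      have h0 := hz (0 + k) (by omega)
      rw [hf, Submodule.finrank_eq_zero] at h0
      rw [h0, Submodule.mem_bot] at hb
      exact ⟨0, Submodule.zero_mem _, by rw [hb, mul_zero]⟩
  · right
    have step : ∀ j, ∀ b ∈ piece I (j + 2), ∃ a ∈ piece I (j + 1), linForm I p * a = b := by
      intro j
      induction j with
      | zero => exact hs
      | succ j ih =>
        intro b hb
        obtain ⟨c, hc, rfl⟩ := piece_succ I (j + 2) b hb
        choose a ha hae using fun l => ih (c l) (hc l)
        refine ⟨∑ l, Ideal.Quotient.mk I (X l) * a l, Submodule.sum_mem _ fun l _ => ?_, ?_⟩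
        · rw [add_comm (j + 1) 1]
          exact piece_mul I ((mem_piece I _ _).2 ⟨_, isHomogeneous_X K l, rfl⟩) (ha l)
        · rw [Finset.mul_sum]
          refine Finset.sum_congr rfl fun l _ => ?_
          rw [← hae l]; ring
    clear hk
    induction k with
    | zero => exact fun b hb => ⟨b, hb, by simp⟩
    | succ k ih =>
      intro b hb
      obtain ⟨j, rfl⟩ : ∃ j, i = j + 1 := ⟨i - 1, by omega⟩
      have e : j + 1 + (k + 1) = (j + k) + 2 := by omega
      rw [e] at hb
      obtain ⟨a, ha, hae⟩ := step _ b hb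
      have e' : j + k + 1 = j + 1 + k := by omega
      rw [e'] at ha
      obtain ⟨a', ha', hae'⟩ := ih a ha
      exact ⟨a', ha', by rw [← hae, ← hae']; ring⟩

end pieces

/-- Any artinian Gorenstein algebra with h-vector `(1,4,4,…,4,1)` of socle degree
`d ≥ 2` has the SLP. -/
theorem slp_1444441 {K : Type*} [Field K] [IsAlgClosed K] [CharZero K] (d : ℕ)
    (hd : 2 ≤ d)
    (I : Ideal (MvPolynomial (Fin 4) K))
    (hAG : IsArtinianGorenstein I d)
    (h0 : hf I 0 = 1) (hd1 : hf I d = 1)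
    (hmid : ∀ i : ℕ, 1 ≤ i → i ≤ d - 1 → hf I i = 4) :
    SLP I := by
  classical
  obtain ⟨hI, -, hz, -, -, hsoc⟩ := hAG
  have hne : piece I d ≠ ⊥ := by
    intro h
    rw [hf, h, finrank_bot] at hd1
    exact zero_ne_one hd1
  obtain ⟨G, hG, hGp⟩ := aux_power (linForm I) (piece I)
    (by simp only [linForm_single]; exact piece_succ I) d hne
  rcases hd.eq_or_lt with rfl | hd3
  · obtain ⟨p, hp⟩ := aux_exists_point G hG
    refine slp_of_form I 2 hz p (hGp p hp) fun b hb => ?_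
    have hl := linForm_mem I p
    have h2 : linForm I p ^ 2 ∈ piece I 2 := by rw [pow_two]; exact piece_mul I hl hl
    obtain ⟨c, hc⟩ := (finrank_eq_one_iff_of_nonzero' (⟨_, h2⟩ : piece I 2)
      (by simpa using hGp p hp)).1 hd1 ⟨b, hb⟩
    refine ⟨c • linForm I p, Submodule.smul_mem _ _ hl, ?_⟩
    rw [mul_smul_comm, ← pow_two]
    exact congrArg Subtype.val hc
  · have hinj : Function.Injective (linForm I) := by
      rw [← LinearMap.ker_eq_bot, ← Submodule.finrank_eq_zero (R := K)]
      have e1 := LinearMap.finrank_range_add_finrank_ker (linForm I)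
      have e2 := hmid 1 le_rfl (by omega)
      rw [hf] at e2
      rw [linForm_range, e2] at e1
      simpa using e1
    have soc : ∀ i, i ≠ d → ∀ a ∈ piece I i, (∀ z, a * linForm I z = 0) → a = 0 := by
      intro i hi a ha h
      refine piece_disjoint I hI hi a ha (hsoc ?_)
      rw [socle, Submodule.mem_iInf]
      intro l
      rw [LinearMap.mem_ker, LinearMap.mulLeft_apply, mul_comm, ← linForm_single]
      exact h _
    have hm : ∀ v w, linForm I v * linForm I w ∈ piece I 2 := fun v w =>
      piece_mul I (linForm_mem I v) (linForm_mem I w)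
    obtain ⟨D, hD, hDp⟩ := aux_generic (linForm I) (piece I 2) (hmid 2 (by omega) (by omega)) hm
      (fun v h => hinj (by rw [map_zero]; exact soc 1 (by omega) _ (linForm_mem I v) h))
      (fun v w h => soc 2 (by omega) _ (hm v w) h)
    obtain ⟨p, hp⟩ := aux_exists_point _ (mul_ne_zero hG hD)
    rw [map_mul] at hp
    refine slp_of_form I d hz p (hGp p (left_ne_zero_of_mul hp)) fun b hb => ?_
    obtain ⟨v, hv⟩ := hDp p (right_ne_zero_of_mul hp) b hb
    exact ⟨_, linForm_mem I v, hv⟩
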